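/- Let X be a nonempty set, K ≥ 1, let g : X → (Fin K → ℝ), let w : Fin K → ℝ with w k ≥ 0 for all k and ∑_k w k = 1, let r ∈ (0,1], and define h(x) = max{ (1/r) ∑_k λ_k · g(x) k : 0 ≤ λ_k ≤ w k for all k, ∑_k λ_k = r }. If x* ∈ X is the UNIQUE minimizer of h over X (h(x*) ≤ h(x) for all x ∈ X, and h(x) = h(x*) implies x = x*), then x* is efficient (Pareto optimal) for the multiobjective problem min_{x ∈ X} (g(x) 1, …, g(x) K): there is no x ∈ X with g(x) k ≤ g(x*) k for all k and g(x) i < g(x*) i for some i. -/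

import Mathlib

/-- The set of values whose supremum is the `r`-OWA of `a` is bounded above. -/
theorem bddAbove_rOWA_values {ι : Type*} [Fintype ι] (a w : ι → ℝ) {r : ℝ} (hr : 0 < r) :
    BddAbove {s : ℝ | ∃ lam : ι → ℝ, (∀ k, 0 ≤ lam k ∧ lam k ≤ w k) ∧ (∑ k, lam k = r) ∧
      s = (1 / r) * ∑ k, lam k * a k} := by
  refine ⟨(1 / r) * ∑ k, w k * |a k|, ?_⟩
  rintro s ⟨lam, hlam, -, rfl⟩
  refine mul_le_mul_of_nonneg_left (Finset.sum_le_sum fun k _ => ?_) (by positivity)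
  exact (mul_le_mul_of_nonneg_left (le_abs_self _) (hlam k).1).trans
    (mul_le_mul_of_nonneg_right (hlam k).2 (abs_nonneg _))

/-- The `r`-OWA is monotone in the vector it aggregates. -/
theorem rOWA_mono {ι : Type*} [Fintype ι] {a b w : ι → ℝ} {r : ℝ} (hw0 : ∀ k, 0 ≤ w k)
    (hw1 : ∑ k, w k = 1) (hr0 : 0 < r) (hr1 : r ≤ 1) (hab : ∀ k, a k ≤ b k) :
    sSup {s : ℝ | ∃ lam : ι → ℝ, (∀ k, 0 ≤ lam k ∧ lam k ≤ w k) ∧ (∑ k, lam k = r) ∧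
      s = (1 / r) * ∑ k, lam k * a k} ≤
    sSup {s : ℝ | ∃ lam : ι → ℝ, (∀ k, 0 ≤ lam k ∧ lam k ≤ w k) ∧ (∑ k, lam k = r) ∧
      s = (1 / r) * ∑ k, lam k * b k} := by
  refine csSup_le ⟨_, fun k => r * w k, fun k => ⟨mul_nonneg hr0.le (hw0 k),
    mul_le_of_le_one_left (hw0 k) hr1⟩, by rw [← Finset.mul_sum, hw1, mul_one], rfl⟩ ?_
  rintro s ⟨lam, hlam, hsum, rfl⟩
  refine le_trans ?_ (le_csSup (bddAbove_rOWA_values b w hr0) ⟨lam, hlam, hsum, rfl⟩)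
  exact mul_le_mul_of_nonneg_left
    (Finset.sum_le_sum fun k _ => mul_le_mul_of_nonneg_left (hab k) (hlam k).1) (by positivity)

/-- The unique minimizer of the r-OWA scalarization h(x) = O_r(g(x)) is efficient (Pareto
optimal) for the multiobjective problem. -/
theorem rOWA_unique_minimizer_efficient
    {X : Type*} [Nonempty X]
    (K : ℕ) (hK : 1 ≤ K) (g : X → Fin K → ℝ)
    (w : Fin K → ℝ) (hw0 : ∀ k, 0 ≤ w k) (hw1 : ∑ k, w k = 1)
    (r : ℝ) (hr0 : 0 < r) (hr1 : r ≤ 1)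
    (h : X → ℝ)
    (hh : h = fun x => sSup {s : ℝ | ∃ lam : Fin K → ℝ,
      (∀ k, 0 ≤ lam k ∧ lam k ≤ w k) ∧ (∑ k, lam k = r) ∧
      s = (1 / r) * ∑ k, lam k * g x k})
    (xstar : X) (hmin : ∀ x : X, h xstar ≤ h x)
    (huniq : ∀ x : X, h x = h xstar → x = xstar) :
    ¬ ∃ x : X, (∀ k, g x k ≤ g xstar k) ∧ (∃ i, g x i < g xstar i) := by
  rintro ⟨x, hle, i, hlt⟩
  have hx : h x ≤ h xstar := by
    subst hh
    exact rOWA_mono hw0 hw1 hr0 hr1 hle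
  rw [huniq x (hx.antisymm (hmin x))] at hlt
  exact lt_irrefl _ hlt
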